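/- Let q and y be complex numbers with |q| < |y|^2 < 1. Then (-y;q)_inf (-q/y;q)_inf / ( (y^2;q)_inf (q/y^2;q)_inf (q;q)_inf ) = (q;q)_inf^{-1} sum_{n in Z} y^{-n} V_n(q), where the bilateral series on the right converges absolutely. -/

import Mathlib

open scoped BigOperators

noncomputable section

/-- Finite q-Pochhammer symbol `(a;q)_n`. -/
def qP (q a : ℂ) (n : ℕ) : ℂ := ∏ m ∈ Finset.range n, (1 - a * q ^ m)

/-- Infinite q-Pochhammer symbol `(a;q)_∞`. -/
def qPInf (q a : ℂ) : ℂ := ∏' m : ℕ, (1 - a * q ^ m)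

/-- `C(n,2) = n(n-1)/2` for `n : ℤ` (exact integer division). -/
def ch2 (n : ℤ) : ℤ := n * (n - 1) / 2

/-- Graded parafermion Verma character `V_t(q)`. -/
def V (q : ℂ) (t : ℤ) : ℂ :=
  (qPInf q q)⁻¹ * ∑' ij : ℕ × ℕ,
    q ^ (ch2 (2 * (ij.2 : ℤ) - 2 * (ij.1 : ℤ) - t) + (ij.2 : ℤ)) *
      ((qP q q ij.1)⁻¹ * (qP q q ij.2)⁻¹)


/-! Elementary facts on exponents -/

lemma two_ch2 (n : ℤ) : 2 * ch2 n = n * (n - 1) := by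
  unfold ch2
  exact Int.mul_ediv_cancel' (Int.even_mul_pred_self n).two_dvd

lemma ch2_nonneg (n : ℤ) : 0 ≤ ch2 n := by
  have h := two_ch2 n
  have : 0 ≤ n * (n - 1) := by
    rcases le_or_gt n 0 with h0 | h0
    · nlinarith
    · nlinarith
  linarith

def T (n : ℤ) : ℕ := (ch2 n).toNat

lemma T_cast (n : ℤ) : ((T n : ℕ) : ℤ) = ch2 n := Int.toNat_of_nonneg (ch2_nonneg n)

lemma two_T (n : ℤ) : 2 * ((T n : ℕ) : ℤ) = n * (n - 1) := by
  rw [T_cast, two_ch2]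

lemma T_zero : T 0 = 0 := by simp [T, ch2]

lemma T_succ (n : ℕ) : T ((n : ℤ) + 1) = T n + n := by
  have h1 := two_T ((n : ℤ) + 1)
  have h2 := two_T (n : ℤ)
  zify
  linarith

lemma T_neg (n : ℕ) : T (-((n : ℤ) + 1 + 1)) = T (-((n : ℤ) + 1)) + (n + 2) := by
  have h1 := two_T (-((n : ℤ) + 1 + 1))
  have h2 := two_T (-((n : ℤ) + 1))
  zify
  linarith

lemma T_add_nat (k j : ℕ) : T ((k : ℤ) + j) + j = T k + (T j + (k + 1) * j) := by
  have h1 := two_T ((k : ℤ) + j)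
  have h2 := two_T (k : ℤ)
  have h3 := two_T (j : ℤ)
  zify
  linarith

lemma T_add_neg (p j : ℕ) :
    T (-((p : ℤ) + 1) + j) + j + p * j = T (-((p : ℤ) + 1)) + T j := by
  have h1 := two_T (-((p : ℤ) + 1) + j)
  have h2 := two_T (-((p : ℤ) + 1))
  have h3 := two_T (j : ℤ)
  zify
  linarith

/-! Basic facts on q-Pochhammer symbols -/

lemma qP_succ (q a : ℂ) (n : ℕ) : qP q a (n + 1) = qP q a n * (1 - a * q ^ n) := by
  simp [qP, Finset.prod_range_succ]

lemma qP_zero (q a : ℂ) : qP q a 0 = 1 := by simp [qP]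

lemma one_sub_ne (q : ℂ) (hq : ‖q‖ < 1) (n : ℕ) : 1 - q * q ^ n ≠ 0 := by
  intro h
  have h1 : q ^ (n + 1) = 1 := by rw [pow_succ']; linear_combination -h
  have h2 : ‖q‖ ^ (n + 1) < 1 := pow_lt_one₀ (norm_nonneg _) hq (by omega)
  rw [← norm_pow, h1] at h2
  simp at h2

lemma qP_ne (q : ℂ) (hq : ‖q‖ < 1) (n : ℕ) : qP q q n ≠ 0 := by
  unfold qP
  exact Finset.prod_ne_zero_iff.2 fun m _ => one_sub_ne q hq m

lemma mult_qP (q a : ℂ) (hq : ‖q‖ < 1) : Multipliable (fun m : ℕ => 1 - a * q ^ m) := by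
  have : Summable (fun m : ℕ => ‖-(a * q ^ m)‖) := by
    simp only [norm_neg, norm_mul, norm_pow]
    exact (summable_geometric_of_lt_one (norm_nonneg _) hq).mul_left _
  simpa [sub_eq_add_neg] using multipliable_one_add_of_summable this

lemma tendsto_qP (q a : ℂ) (hq : ‖q‖ < 1) :
    Filter.Tendsto (qP q a) Filter.atTop (nhds (qPInf q a)) :=
  (mult_qP q a hq).hasProd.tendsto_prod_nat

lemma qP_add (q a : ℂ) (k n : ℕ) : qP q a (k + n) = qP q a k * qP q (a * q ^ k) n := by
  simp only [qP, Finset.prod_range_add]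
  congr 1
  refine Finset.prod_congr rfl fun m _ => ?_
  ring

lemma qPInf_split (q a : ℂ) (hq : ‖q‖ < 1) (k : ℕ) :
    qPInf q a = qP q a k * qPInf q (a * q ^ k) := by
  have h1 := (tendsto_qP q (a * q ^ k) hq).const_mul (qP q a k)
  have h2 := (tendsto_qP q a hq).comp (Filter.tendsto_add_atTop_nat k)
  refine tendsto_nhds_unique h2 (h1.congr fun n => ?_)
  simp [← qP_add, add_comm]

/-! A ratio test and an Abel type limit -/

lemma ratio_test (f g : ℕ → ℂ) (l : ℂ) (hl : ‖l‖ < 1) (hg : Filter.Tendsto g Filter.atTop (nhds l))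
    (h : ∀ n, f (n + 1) = g n * f n) : Summable f := by
  obtain ⟨r, hr1, hr2⟩ := exists_between hl
  refine summable_of_ratio_norm_eventually_le hr2 ?_
  filter_upwards [hg.norm.eventually (gt_mem_nhds hr1)] with n hn
  rw [h, norm_mul]
  exact mul_le_mul_of_nonneg_right hn.le (norm_nonneg _)

lemma tendsto_qpow (q : ℂ) (hq : ‖q‖ < 1) :
    Filter.Tendsto (fun n : ℕ => q ^ n) Filter.atTop (nhds 0) :=
  tendsto_pow_atTop_nhds_zero_of_norm_lt_one hq

lemma tendsto_inv_one_sub (q : ℂ) (hq : ‖q‖ < 1) :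
    Filter.Tendsto (fun n : ℕ => (1 - q * q ^ n)⁻¹) Filter.atTop (nhds 1) := by
  have h := ((tendsto_qpow q hq).const_mul q).const_sub 1
  have h2 := h.inv₀ (by simp)
  simpa using h2

lemma abel_lim (q : ℂ) (hq : ‖q‖ < 1) (c : ℕ → ℂ) (hc : Summable c) :
    Filter.Tendsto (fun N : ℕ => ∑' n, c n * (q ^ N) ^ n) Filter.atTop (nhds (c 0)) := by
  have key := tendsto_tsum_of_dominated_convergence (𝓕 := Filter.atTop)
    (f := fun (N : ℕ) (n : ℕ) => c n * (q ^ N) ^ n) (g := fun n => if n = 0 then c 0 else 0)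
    (bound := fun n => ‖c n‖) hc.norm ?_ ?_
  · simpa using key
  · intro n
    rcases Nat.eq_zero_or_pos n with rfl | hn
    · simp
    · have := ((tendsto_qpow q hq).pow n).const_mul (c n)
      simpa [hn.ne'] using this
  · refine Filter.Eventually.of_forall fun N n => ?_
    rw [norm_mul, norm_pow, norm_pow]
    exact mul_le_of_le_one_right (norm_nonneg _)
      (pow_le_one₀ (by positivity) (pow_le_one₀ (norm_nonneg _) hq.le))

/-! Euler's identities -/

lemma sum_E1 (q z : ℂ) (hq : ‖q‖ < 1) (hz : ‖z‖ < 1) :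
    Summable (fun n : ℕ => z ^ n * (qP q q n)⁻¹) := by
  refine ratio_test _ (fun n => z * (1 - q * q ^ n)⁻¹) z hz ?_ ?_
  · simpa using (tendsto_inv_one_sub q hq).const_mul z
  · intro n
    rw [qP_succ, mul_inv]; ring

lemma sum_E2 (q z : ℂ) (hq : ‖q‖ < 1) :
    Summable (fun n : ℕ => q ^ T n * z ^ n * (qP q q n)⁻¹) := by
  refine ratio_test _ (fun n => z * q ^ n * (1 - q * q ^ n)⁻¹) 0 (by simp) ?_ ?_
  · simpa using ((tendsto_qpow q hq).const_mul z).mul (tendsto_inv_one_sub q hq)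
  · intro n
    push_cast
    rw [qP_succ, mul_inv, T_succ]; ring

lemma euler1 (q z : ℂ) (hq : ‖q‖ < 1) (hz : ‖z‖ < 1) :
    (∑' n : ℕ, z ^ n * (qP q q n)⁻¹) * qPInf q z = 1 := by
  set F : ℂ → ℂ := fun z => ∑' n : ℕ, z ^ n * (qP q q n)⁻¹ with hF
  have step : ∀ z : ℂ, ‖z‖ < 1 → F z * (1 - z) = F (z * q) := by
    intro z hz
    have hzq : ‖z * q‖ < 1 := by
      rw [norm_mul]; nlinarith [norm_nonneg z, norm_nonneg q]
    have s1 := sum_E1 q z hq hz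
    have s2 := sum_E1 q (z * q) hq hzq
    have e : F z - F (z * q) = z * F z := by
      simp only [hF]
      rw [← s1.tsum_sub s2, (s1.sub s2).tsum_eq_zero_add, ← tsum_mul_left]
      simp only [pow_zero, sub_self, zero_add]
      refine tsum_congr fun n => ?_
      have h1 := one_sub_ne q hq n
      have h2 := qP_ne q hq n
      rw [qP_succ]
      field_simp
      ring
    linear_combination e
  have hN : ∀ N : ℕ, F z * qP q z N = F (z * q ^ N) := by
    intro N
    induction N with
    | zero => simp [qP_zero]
    | succ N ih =>
      have hzq : ‖z * q ^ N‖ < 1 := by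
        rw [norm_mul, norm_pow]
        have : ‖q‖ ^ N ≤ 1 := pow_le_one₀ (norm_nonneg _) hq.le
        nlinarith [norm_nonneg z]
      rw [qP_succ, ← mul_assoc, ih, step _ hzq, pow_succ, mul_assoc]
  have l1 := (tendsto_qP q z hq).const_mul (F z)
  have l2 := abel_lim q hq _ (sum_E1 q z hq hz)
  refine tendsto_nhds_unique l1 ?_
  simp only [pow_zero, qP_zero, inv_one, mul_one] at l2
  refine l2.congr fun N => ?_
  rw [hN]
  refine tsum_congr fun n => ?_
  rw [mul_pow]; ring

lemma euler2 (q z : ℂ) (hq : ‖q‖ < 1) :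
    ∑' n : ℕ, q ^ T n * z ^ n * (qP q q n)⁻¹ = qPInf q (-z) := by
  set F : ℂ → ℂ := fun z => ∑' n : ℕ, q ^ T n * z ^ n * (qP q q n)⁻¹ with hF
  have step : ∀ z : ℂ, F z = (1 + z) * F (z * q) := by
    intro z
    have s1 := sum_E2 q z hq
    have s2 := sum_E2 q (z * q) hq
    have e : F z - F (z * q) = z * F (z * q) := by
      simp only [hF]
      rw [← s1.tsum_sub s2, (s1.sub s2).tsum_eq_zero_add, ← tsum_mul_left]
      simp only [pow_zero, sub_self, zero_add]
      refine tsum_congr fun n => ?_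
      have h1 := one_sub_ne q hq n
      have h2 := qP_ne q hq n
      push_cast
      rw [qP_succ, T_succ]
      field_simp
      ring
    linear_combination e
  have hN : ∀ N : ℕ, F z = qP q (-z) N * F (z * q ^ N) := by
    intro N
    induction N with
    | zero => simp [qP_zero]
    | succ N ih =>
      rw [ih, qP_succ, step (z * q ^ N), pow_succ, mul_assoc z]; ring
  have l2 := abel_lim q hq _ (sum_E2 q z hq)
  have l1 := (tendsto_qP q (-z) hq).mul l2
  simp only [pow_zero, qP_zero, inv_one, mul_one, Nat.cast_zero, T_zero] at l1
  refine tendsto_nhds_unique (tendsto_const_nhds (x := F z) (f := Filter.atTop (α := ℕ))) (l1.congr fun N => ?_)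
  rw [hN N]
  congr 1
  refine tsum_congr fun n => ?_
  rw [mul_pow]; ring

lemma qPInf_ne (q z : ℂ) (hq : ‖q‖ < 1) (hz : ‖z‖ < 1) : qPInf q z ≠ 0 :=
  right_ne_zero_of_mul_eq_one (euler1 q z hq hz)

/-! Jacobi triple product -/

lemma sum_theta (q y : ℂ) (hq : ‖q‖ < 1) (hy : y ≠ 0) :
    Summable (fun m : ℤ => y ^ m * q ^ T m) := by
  refine Summable.of_nat_of_neg_add_one ?_ ?_
  · refine ratio_test _ (fun n => y * q ^ n) 0 (by simp) ?_ ?_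
    · simpa using (tendsto_qpow q hq).const_mul y
    · intro n
      push_cast
      rw [T_succ, zpow_add₀ hy]
      simp only [zpow_one, zpow_natCast]; ring
  · refine ratio_test _ (fun n => y⁻¹ * q ^ 2 * q ^ n) 0 (by simp) ?_ ?_
    · simpa using (tendsto_qpow q hq).const_mul (y⁻¹ * q ^ 2)
    · intro n
      push_cast
      rw [T_neg, neg_add _ (1 : ℤ), zpow_add₀ hy]
      simp only [zpow_neg_one]; ring

lemma inner_nonneg_case (q : ℂ) (hq : ‖q‖ < 1) (k : ℕ) :
    ∑' j : ℕ, (-1) ^ j * q ^ (T ((k : ℤ) + j) + j) * (qP q q j)⁻¹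
      = q ^ T k * ((qP q q k)⁻¹ * qPInf q q) := by
  have h := euler2 q (-(q * q ^ k)) hq
  rw [neg_neg] at h
  rw [qPInf_split q q hq k, inv_mul_cancel_left₀ (qP_ne q hq k), ← h, ← tsum_mul_left]
  refine tsum_congr fun j => ?_
  rw [T_add_nat, pow_add, pow_add, pow_mul, neg_pow (q * q ^ k), ← pow_succ']
  ring

lemma inner_neg_case (q : ℂ) (hq : ‖q‖ < 1) (p : ℕ) :
    ∑' j : ℕ, (-1) ^ j * q ^ (T (-((p : ℤ) + 1) + j) + j) * (qP q q j)⁻¹ = 0 := by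
  by_cases h0 : q = 0
  · have : ∀ j : ℕ, T (-((p : ℤ) + 1) + j) + j ≠ 0 := by
      intro j hj
      have hj0 : j = 0 := by omega
      subst hj0
      have h1 := two_T (-((p : ℤ) + 1) + (0 : ℕ))
      have h2 : T (-((p : ℤ) + 1) + (0 : ℕ)) = 0 := by omega
      rw [h2] at h1
      push_cast at h1
      nlinarith
    rw [h0]
    simp only [zero_pow (this _), mul_zero, zero_mul, tsum_zero]
  · have h := euler2 q (-((q ^ p)⁻¹)) hq
    rw [neg_neg] at h
    have hz : qPInf q ((q ^ p)⁻¹) = 0 := by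
      unfold qPInf
      refine tprod_of_exists_eq_zero ⟨p, ?_⟩
      rw [inv_mul_cancel₀ (pow_ne_zero _ h0), sub_self]
    rw [hz] at h
    rw [← mul_zero (q ^ T (-((p : ℤ) + 1))), ← h, ← tsum_mul_left]
    refine tsum_congr fun j => ?_
    have e := congrArg (fun n => q ^ n) (T_add_neg p j)
    simp only [pow_add q _ (T (j : ℤ)), pow_add q _ (p * j), pow_mul] at e
    have hne : (q ^ p) ^ j ≠ 0 := pow_ne_zero _ (pow_ne_zero _ h0)
    rw [neg_pow ((q ^ p)⁻¹), inv_pow]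
    field_simp
    linear_combination (qP q q j)⁻¹ * e

def shiftE : ℤ × ℕ ≃ ℤ × ℕ where
  toFun p := (p.1 + p.2, p.2)
  invFun p := (p.1 - p.2, p.2)
  left_inv p := by simp
  right_inv p := by simp

lemma jtp (q y : ℂ) (hq : ‖q‖ < 1) (hqy : ‖q‖ < ‖y‖) :
    ∑' m : ℤ, y ^ m * q ^ T m = qPInf q (-y) * qPInf q (-(q / y)) * qPInf q q := by
  have hy : y ≠ 0 := by
    rintro rfl
    simp at hqy
    linarith [norm_nonneg q]
  have hz : ‖-(q / y)‖ < 1 := by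
    rw [norm_neg, norm_div, div_lt_one (norm_pos_iff.2 hy)]; exact hqy
  have s1 := sum_theta q y hq hy
  have s2 := sum_E1 q _ hq hz
  have sB := summable_mul_of_summable_norm s1.norm s2.norm
  have eB := tsum_mul_tsum_of_summable_norm s1.norm s2.norm
  rw [← shiftE.tsum_eq] at eB
  have sA := shiftE.summable_iff.2 sB
  have eA := sA.tsum_prod
  simp only [Function.comp_def] at eA
  rw [eA] at eB
  have inner : ∀ k : ℤ, (∑' j : ℕ, (y ^ (shiftE (k, j)).1 * q ^ T (shiftE (k, j)).1) *
      ((-(q / y)) ^ (shiftE (k, j)).2 * (qP q q (shiftE (k, j)).2)⁻¹))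
      = y ^ k * ∑' j : ℕ, (-1) ^ j * q ^ (T (k + j) + j) * (qP q q j)⁻¹ := by
    intro k
    rw [← tsum_mul_left]
    refine tsum_congr fun j => ?_
    simp only [shiftE, Equiv.coe_fn_mk]
    rw [zpow_add₀ hy, zpow_natCast, neg_pow, div_pow, pow_add]
    field_simp
  simp only [inner] at eB
  have outer : (∑' k : ℤ, y ^ k * ∑' j : ℕ, (-1) ^ j * q ^ (T (k + j) + j) * (qP q q j)⁻¹)
      = qPInf q (-y) * qPInf q q := by
    rw [← Function.Injective.tsum_eq (g := ((↑) : ℕ → ℤ)) Nat.cast_injective, ← euler2 q y hq,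
      ← tsum_mul_right]
    · refine tsum_congr fun k => ?_
      rw [inner_nonneg_case q hq k, zpow_natCast]; ring
    · intro k hk
      by_contra hk'
      apply hk
      have : k < 0 := by
        by_contra h
        exact hk' ⟨k.toNat, Int.toNat_of_nonneg (by omega)⟩
      obtain ⟨p, rfl⟩ : ∃ p : ℕ, k = -((p : ℤ) + 1) := ⟨(-k - 1).toNat, by omega⟩
      simp only [inner_neg_case q hq p, mul_zero]
  rw [outer] at eB
  have e1 := euler1 q _ hq hz
  linear_combination (-(∑' m : ℤ, y ^ m * q ^ T m)) * e1 + qPInf q (-(q / y)) * eB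

def reE : ℤ × (ℕ × ℕ) ≃ ℤ × (ℕ × ℕ) where
  toFun p := (2 * (p.2.2 : ℤ) - 2 * (p.2.1 : ℤ) - p.1, p.2)
  invFun p := (2 * (p.2.2 : ℤ) - 2 * (p.2.1 : ℤ) - p.1, p.2)
  left_inv p := by simp
  right_inv p := by simp

lemma zpow_ch2 (q : ℂ) (m : ℤ) (j : ℕ) : q ^ (ch2 m + (j : ℤ)) = q ^ T m * q ^ j := by
  rw [← T_cast, ← Nat.cast_add, zpow_natCast, pow_add]

/-- Expansion of the `osp(1,2)` character denominator in terms of Verma characters. -/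
theorem denominator_verma_expansion (q y : ℂ)
    (hqy : ‖q‖ < ‖y‖ ^ 2) (hy : ‖y‖ ^ 2 < 1) :
    Summable (fun n : ℤ => ‖y ^ (-n) * V q n‖) ∧
    qPInf q (-y) * qPInf q (-(q / y)) /
        (qPInf q (y ^ 2) * qPInf q (q / y ^ 2) * qPInf q q)
      = (qPInf q q)⁻¹ * ∑' n : ℤ, y ^ (-n) * V q n := by
  have hq : ‖q‖ < 1 := hqy.trans hy
  have hy0 : y ≠ 0 := by
    rintro rfl
    simp at hqy
    linarith [norm_nonneg q]
  have hy1 : ‖y‖ < 1 := by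
    by_contra h
    push Not at h
    nlinarith
  have hqy' : ‖q‖ < ‖y‖ := by nlinarith [norm_nonneg y]
  have hz1 : ‖y ^ 2‖ < 1 := by rwa [norm_pow]
  have hz2 : ‖q / y ^ 2‖ < 1 := by
    rw [norm_div, norm_pow, div_lt_one (by positivity)]; exact hqy
  have s0 := sum_theta q y hq hy0
  have s1 := sum_E1 q _ hq hz1
  have s2 := sum_E1 q _ hq hz2
  have s12 := summable_mul_of_summable_norm s1.norm s2.norm
  have e12 := tsum_mul_tsum_of_summable_norm s1.norm s2.norm
  have sB := summable_mul_of_summable_norm s0.norm s12.norm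
  have eB := tsum_mul_tsum_of_summable_norm s0.norm s12.norm
  rw [← reE.tsum_eq] at eB
  have sA := reE.summable_iff.2 sB
  have eA := sA.tsum_prod
  have sP := sA.prod
  simp only [Function.comp_def] at eA sP
  rw [eA] at eB
  have inner : ∀ n : ℤ, (∑' c : ℕ × ℕ, (y ^ (reE (n, c)).1 * q ^ T (reE (n, c)).1) *
      (((y ^ 2) ^ (reE (n, c)).2.1 * (qP q q (reE (n, c)).2.1)⁻¹) *
       ((q / y ^ 2) ^ (reE (n, c)).2.2 * (qP q q (reE (n, c)).2.2)⁻¹)))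
      = qPInf q q * (y ^ (-n) * V q n) := by
    intro n
    unfold V
    rw [mul_left_comm, mul_inv_cancel_left₀ (qPInf_ne q q hq hq), ← tsum_mul_left]
    refine tsum_congr fun c => ?_
    simp only [reE, Equiv.coe_fn_mk]
    rw [zpow_ch2]
    have : y ^ (2 * (c.2 : ℤ) - 2 * (c.1 : ℤ) - n) = (y ^ 2) ^ c.2 * ((y ^ 2) ^ c.1)⁻¹ * y ^ (-n) := by
      rw [sub_eq_add_neg, zpow_add₀ hy0, zpow_sub₀ hy0, zpow_mul, zpow_mul, zpow_natCast,
        zpow_natCast, div_eq_mul_inv]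
      norm_cast
    rw [this, div_pow]
    have h1 : (y ^ 2) ^ c.1 ≠ 0 := pow_ne_zero _ (pow_ne_zero _ hy0)
    have h2 : (y ^ 2) ^ c.2 ≠ 0 := pow_ne_zero _ (pow_ne_zero _ hy0)
    generalize (y ^ 2) ^ c.1 = A at *
    generalize (y ^ 2) ^ c.2 = B at *
    field_simp
  simp only [inner] at eB sP
  have hne := qPInf_ne q q hq hq
  refine ⟨((summable_mul_left_iff hne).1 sP).norm, ?_⟩
  rw [tsum_mul_left, ← e12, jtp q y hq hqy'] at eB
  have n1 := qPInf_ne q _ hq hz1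
  have n2 := qPInf_ne q _ hq hz2
  rw [eq_inv_of_mul_eq_one_left (euler1 q _ hq hz1),
    eq_inv_of_mul_eq_one_left (euler1 q _ hq hz2)] at eB
  have eC := mul_left_cancel₀ hne (eB.symm.trans (by ring :
    _ = qPInf q q * (qPInf q (-y) * qPInf q (-(q / y)) *
      ((qPInf q (y ^ 2))⁻¹ * (qPInf q (q / y ^ 2))⁻¹)))) 
  rw [eC]
  field_simp
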